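/- arXiv:1404.6556 — 5 statements merged into one kernel-verified Lean document; each statement's English description precedes it below -/
import Mathlib

section
/- Let m > 0 be a real number, let T be a nonnegative random variable on a probability space with E[T^m] < ∞, and let h be a nonnegative random variable independent of T whose cumulative distribution function F satisfies F(t)/t^m → a as t → 0+ for some constant a ∈ (0, ∞). Then lim_{θ→0+} P(h ≤ θ·T)/θ^m = a·E[T^m]. -/
open MeasureTheory Filter Topology

/-- For independent `h` and `T`, `P(h ≤ θ T)` is the mean of the distribution function of `h`
evaluated at `θ T`. -/
lemma measure_le_mul_toReal_eq_integral {Ω : Type*} [MeasurableSpace Ω] (μ : Measure Ω)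
    [IsProbabilityMeasure μ] {T h : Ω → ℝ} (hT : Measurable T) (hh : Measurable h)
    (hindep : ProbabilityTheory.IndepFun h T μ) (θ : ℝ) :
    (μ {ω | h ω ≤ θ * T ω}).toReal = ∫ ω, (μ {ω' | h ω' ≤ θ * T ω}).toReal ∂μ := by
  have hS : MeasurableSet {p : ℝ × ℝ | p.1 ≤ θ * p.2} :=
    measurableSet_le measurable_fst (measurable_snd.const_mul θ)
  have hmono : Monotone fun t : ℝ => μ {ω' | h ω' ≤ t} := fun s t hst =>
    measure_mono fun ω (hω : h ω ≤ s) => hω.trans hst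
  have hmeas : Measurable fun y : ℝ => μ {ω' | h ω' ≤ θ * y} :=
    hmono.measurable.comp (measurable_id.const_mul θ)
  have hkey : μ {ω | h ω ≤ θ * T ω} = ∫⁻ ω, μ {ω' | h ω' ≤ θ * T ω} ∂μ := by
    have := Measure.isProbabilityMeasure_map (μ := μ) hh.aemeasurable
    have := Measure.isProbabilityMeasure_map (μ := μ) hT.aemeasurable
    calc μ {ω | h ω ≤ θ * T ω}
        = μ.map (fun ω => (h ω, T ω)) {p : ℝ × ℝ | p.1 ≤ θ * p.2} :=
          (Measure.map_apply (hh.prodMk hT) hS).symm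
      _ = ∫⁻ y, μ.map h ((fun x => (x, y)) ⁻¹' {p : ℝ × ℝ | p.1 ≤ θ * p.2}) ∂(μ.map T) := by
          rw [(ProbabilityTheory.indepFun_iff_map_prod_eq_prod_map_map hh.aemeasurable
            hT.aemeasurable).1 hindep, Measure.prod_apply_symm hS]
      _ = ∫⁻ y, μ {ω' | h ω' ≤ θ * y} ∂(μ.map T) :=
          lintegral_congr fun y => Measure.map_apply hh (measurable_prodMk_right hS)
      _ = ∫⁻ ω, μ {ω' | h ω' ≤ θ * T ω} ∂μ := lintegral_map hmeas hT
  rw [hkey]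
  exact (integral_toReal (hmeas.comp hT).aemeasurable
    (Eventually.of_forall fun ω => measure_lt_top _ _)).symm

/-- A monotone function with `F t / t ^ m → a` as `t → 0⁺` is nonpositive at `0`. -/
lemma Monotone.nonpos_of_tendsto_div_rpow {F : ℝ → ℝ} {m a : ℝ} (hF : Monotone F) (hm : 0 < m)
    (hlim : Tendsto (fun t => F t / t ^ m) (𝓝[>] 0) (𝓝 a)) : F 0 ≤ 0 := by
  have hpow : Tendsto (fun t : ℝ => t ^ m) (𝓝[>] 0) (𝓝 0) := by
    have := (Real.continuousAt_rpow_const 0 m (Or.inr hm.le)).tendsto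
    rw [Real.zero_rpow hm.ne'] at this
    exact this.mono_left nhdsWithin_le_nhds
  have hprod := hlim.mul hpow
  rw [mul_zero] at hprod
  refine _root_.ge_of_tendsto hprod ?_
  filter_upwards [self_mem_nhdsWithin] with t (ht : 0 < t)
  rw [div_mul_cancel₀ _ (Real.rpow_pos_of_pos ht m).ne']
  exact hF ht.le

/-- A monotone function bounded by `1` with `F t / t ^ m → a` as `t → 0⁺` is bounded by a multiple
of `t ^ m` on `[0, ∞)`. -/
lemma Monotone.exists_le_mul_rpow_of_tendsto_div_rpow {F : ℝ → ℝ} {m a : ℝ} (hF : Monotone F)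
    (hF1 : ∀ t, F t ≤ 1) (hm : 0 < m)
    (hlim : Tendsto (fun t => F t / t ^ m) (𝓝[>] 0) (𝓝 a)) :
    ∃ C, ∀ t, 0 ≤ t → F t ≤ C * t ^ m := by
  obtain ⟨δ, hδ, hsub⟩ := mem_nhdsGT_iff_exists_Ioo_subset.1
    (hlim.eventually (gt_mem_nhds (lt_add_one a)))
  have hδ : 0 < δ := hδ
  refine ⟨max (a + 1) (δ ^ m)⁻¹, fun t ht => ?_⟩
  rcases ht.eq_or_lt with rfl | ht
  · simpa [Real.zero_rpow hm.ne'] using hF.nonpos_of_tendsto_div_rpow hm hlim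
  have htm := Real.rpow_pos_of_pos ht m
  rcases lt_or_ge t δ with htδ | htδ
  · have hlt : F t / t ^ m < a + 1 := hsub ⟨ht, htδ⟩
    exact ((div_lt_iff₀ htm).1 hlt).le.trans
      (mul_le_mul_of_nonneg_right (le_max_left _ _) htm.le)
  · have hδm := Real.rpow_pos_of_pos hδ m
    calc F t ≤ (δ ^ m)⁻¹ * δ ^ m := by rw [inv_mul_cancel₀ hδm.ne']; exact hF1 t
      _ ≤ (δ ^ m)⁻¹ * t ^ m := by gcongr
      _ ≤ _ := mul_le_mul_of_nonneg_right (le_max_right _ _) htm.le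

/-- Probabilistic core of Theorem 1: if `T ≥ 0` has `E[T^m] < ∞` and `h ≥ 0` is independent
of `T` with CDF `F` satisfying `F(t)/t^m → a` as `t → 0⁺`, then
`P(h ≤ θ·T)/θ^m → a · E[T^m]` as `θ → 0⁺`. -/
theorem outage_asymptotics {Ω : Type*} [MeasurableSpace Ω] (μ : Measure Ω)
    [IsProbabilityMeasure μ] (m a : ℝ) (hm : 0 < m) (ha : 0 < a)
    (T h : Ω → ℝ) (hT : Measurable T) (hh : Measurable h)
    (hTnn : ∀ ω, 0 ≤ T ω) (hhnn : ∀ ω, 0 ≤ h ω)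
    (hTm : Integrable (fun ω => T ω ^ m) μ)
    (hindep : ProbabilityTheory.IndepFun h T μ)
    (hF : Tendsto (fun t => (μ {ω | h ω ≤ t}).toReal / t ^ m) (𝓝[>] 0) (𝓝 a)) :
    Tendsto (fun θ => (μ {ω | h ω ≤ θ * T ω}).toReal / θ ^ m) (𝓝[>] 0)
      (𝓝 (a * ∫ ω, T ω ^ m ∂μ)) := by
  set F : ℝ → ℝ := fun t => (μ {ω | h ω ≤ t}).toReal with hFdef
  have hmono : Monotone F := fun s t hst =>
    ENNReal.toReal_mono (measure_ne_top _ _)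
      (measure_mono fun ω (hω : h ω ≤ s) => hω.trans hst)
  have hF0 : ∀ t, 0 ≤ F t := fun t => ENNReal.toReal_nonneg
  have hF1 : ∀ t, F t ≤ 1 := fun t => measureReal_le_one
  have hFzero : F 0 = 0 := (hmono.nonpos_of_tendsto_div_rpow hm hF).antisymm (hF0 0)
  obtain ⟨C, hC⟩ := hmono.exists_le_mul_rpow_of_tendsto_div_rpow hF1 hm hF
  have hrepr : ∀ θ, (μ {ω | h ω ≤ θ * T ω}).toReal / θ ^ m
      = ∫ ω, F (θ * T ω) / θ ^ m ∂μ := fun θ => by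
    rw [measure_le_mul_toReal_eq_integral μ hT hh hindep θ, integral_div]
  simp_rw [hrepr, ← integral_const_mul]
  refine tendsto_integral_filter_of_dominated_convergence (fun ω => C * T ω ^ m)
    (Eventually.of_forall fun θ => ?_) ?_ (hTm.const_mul C) (Eventually.of_forall fun ω => ?_)
  · exact ((hmono.measurable.comp (hT.const_mul θ)).div_const _).aestronglyMeasurable
  · filter_upwards [self_mem_nhdsWithin] with θ (hθ : 0 < θ)
    refine Eventually.of_forall fun ω => ?_
    have hθm := Real.rpow_pos_of_pos hθ m
    rw [Real.norm_of_nonneg (div_nonneg (hF0 _) hθm.le), div_le_iff₀ hθm]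
    refine (hC _ (mul_nonneg hθ.le (hTnn ω))).trans_eq ?_
    rw [Real.mul_rpow hθ.le (hTnn ω)]
    ring
  · rcases (hTnn ω).eq_or_lt with h0 | hpos
    · simp [← h0, hFzero, Real.zero_rpow hm.ne']
    · have hscale : Tendsto (fun θ => θ * T ω) (𝓝[>] 0) (𝓝[>] 0) := by
        refine tendsto_nhdsWithin_iff.2 ⟨?_, ?_⟩
        · have : Tendsto (fun θ => θ * T ω) (𝓝 0) (𝓝 (0 * T ω)) := tendsto_id.mul_const _
          rw [zero_mul] at this
          exact this.mono_left nhdsWithin_le_nhds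
        · filter_upwards [self_mem_nhdsWithin] with θ (hθ : 0 < θ) using mul_pos hθ hpos
      refine ((hF.comp hscale).mul_const (T ω ^ m)).congr' ?_
      filter_upwards [self_mem_nhdsWithin] with θ (hθ : 0 < θ)
      have hθm := (Real.rpow_pos_of_pos hθ m).ne'
      have hTm' := (Real.rpow_pos_of_pos hpos m).ne'
      simp only [Function.comp_apply, Real.mul_rpow hθ.le (hTnn ω)]
      field_simp
      rfl
end

section
/- Let m > 0 and κ, κ' ∈ (0, ∞). Suppose f, g : (0, ∞) → ℝ satisfy f(θ)/θ^m → κ and g(θ)/θ^m → κ' as θ → 0+. If (θ_n) and (θ'_n) are sequences of positive reals both tending to 0 such that f(θ_n) = g(θ'_n) for every n, then θ_n/θ'_n → (κ'/κ)^{1/m} as n → ∞. -/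
open Filter Topology

/-- Core of Corollary 1 (existence of the asymptotic deployment gain): if
`f(θ)/θ^m → κ` and `g(θ)/θ^m → κ'` as `θ → 0⁺`, and `(θ_n)`, `(θ'_n)` are positive
sequences tending to `0` with `f(θ_n) = g(θ'_n)` for all `n`, then
`θ_n/θ'_n → (κ'/κ)^(1/m)`. -/
theorem adg_exists (m κ κ' : ℝ) (hm : 0 < m) (hκ : 0 < κ) (hκ' : 0 < κ')
    (f g : ℝ → ℝ)
    (hf : Tendsto (fun θ => f θ / θ ^ m) (𝓝[>] 0) (𝓝 κ))
    (hg : Tendsto (fun θ => g θ / θ ^ m) (𝓝[>] 0) (𝓝 κ'))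
    (θ θ' : ℕ → ℝ) (hθpos : ∀ n, 0 < θ n) (hθ'pos : ∀ n, 0 < θ' n)
    (hθ0 : Tendsto θ atTop (𝓝 0)) (hθ'0 : Tendsto θ' atTop (𝓝 0))
    (heq : ∀ n, f (θ n) = g (θ' n)) :
    Tendsto (fun n => θ n / θ' n) atTop (𝓝 ((κ' / κ) ^ (1 / m))) := by
  have hfθ := hf.comp (tendsto_nhdsWithin_iff.2 ⟨hθ0, .of_forall hθpos⟩)
  have hgθ' := hg.comp (tendsto_nhdsWithin_iff.2 ⟨hθ'0, .of_forall hθ'pos⟩)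
  have hratio := (hgθ'.div hfθ hκ.ne').rpow_const (p := 1 / m)
    (Or.inl (div_pos hκ' hκ).ne')
  refine hratio.congr' ?_
  filter_upwards [hfθ.eventually_ne hκ.ne'] with n hn
  have hfn : f (θ n) ≠ 0 := fun h => hn (by simp [h])
  have hpow : g (θ' n) / θ' n ^ m / (f (θ n) / θ n ^ m) = (θ n / θ' n) ^ m := by
    have := (Real.rpow_pos_of_pos (hθpos n) m).ne'
    have := (Real.rpow_pos_of_pos (hθ'pos n) m).ne'
    rw [← heq n, Real.div_rpow (hθpos n).le (hθ'pos n).le]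
    field_simp
  simp only [Pi.div_apply, Function.comp_apply]
  rw [hpow, one_div, Real.rpow_rpow_inv (div_pos (hθpos n) (hθ'pos n)).le hm.ne']
end

section
/- Let m > 0, σ > 0. Let X be a real Gaussian random variable with mean 0 and variance σ², set ĥ = 10^{X/10} (log-normal shadowing), and let h̃ be a random variable with the Gamma distribution of shape m and rate m (Nakagami-m fading power), independent of X. Let h = h̃·ĥ and let F_h be its cumulative distribution function. Then lim_{t→0+} F_h(t)/t^m = ∫_0^∞ (10 m^{m-1})/(σ (ln 10) √(2π) Γ(m) u^{m+1}) · exp(−(10 ln u / (σ √2 ln 10))²) du, and this integral is finite. -/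
open MeasureTheory Filter Topology Real ProbabilityTheory

lemma lintegral_Icc_rpow_sub_one {a s : ℝ} (ha : 0 < a) (hs : 0 ≤ s) {c : ℝ} (hc : 0 ≤ c) :
    ∫⁻ x in Set.Icc 0 s, ENNReal.ofReal (c * x ^ (a - 1)) = ENNReal.ofReal (c * (s ^ a / a)) := by
  have hint : IntegrableOn (fun x : ℝ => c * x ^ (a - 1)) (Set.Icc 0 s) := by
    have := (intervalIntegral.intervalIntegrable_rpow' (a := 0) (b := s)
      (show -1 < a - 1 by linarith)).const_mul c
    rwa [intervalIntegrable_iff_integrableOn_Icc_of_le hs] at this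
  rw [← ofReal_integral_eq_lintegral_ofReal hint]
  · rw [integral_Icc_eq_integral_Ioc, ← intervalIntegral.integral_of_le hs,
      intervalIntegral.integral_const_mul, integral_rpow (Or.inl (by linarith))]
    simp [ha.ne']
  · refine (ae_restrict_iff' measurableSet_Icc).mpr (ae_of_all _ fun x hx => ?_)
    have := hx.1
    positivity

lemma gammaMeasure_Iic_eq_lintegral {a r s : ℝ} (hs : 0 ≤ s) :
    gammaMeasure a r (Set.Iic s) = ∫⁻ x in Set.Icc 0 s,
      ENNReal.ofReal (r ^ a / Gamma a * x ^ (a - 1) * exp (-(r * x))) := by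
  rw [gammaMeasure, withDensity_apply _ measurableSet_Iic,
    lintegral_Iic_eq_lintegral_Iio_add_Icc _ hs, lintegral_gammaPDF_of_nonpos le_rfl, zero_add]
  exact setLIntegral_congr_fun measurableSet_Icc fun x hx => gammaPDF_of_nonneg hx.1

lemma gammaMeasure_real_Iic_le {a r s : ℝ} (ha : 0 < a) (hr : 0 < r) (hs : 0 ≤ s) :
    (gammaMeasure a r).real (Set.Iic s) ≤ r ^ a / Gamma a * (s ^ a / a) := by
  refine ENNReal.toReal_le_of_le_ofReal (by positivity) ?_
  rw [gammaMeasure_Iic_eq_lintegral hs, ← lintegral_Icc_rpow_sub_one ha hs (by positivity)]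
  refine setLIntegral_mono' measurableSet_Icc fun x hx => ENNReal.ofReal_le_ofReal ?_
  have := hx.1
  exact mul_le_of_le_one_right (by positivity) (exp_le_one_iff.mpr (by nlinarith))

lemma le_gammaMeasure_real_Iic {a r s : ℝ} (ha : 0 < a) (hr : 0 < r) (hs : 0 ≤ s) :
    r ^ a / Gamma a * exp (-(r * s)) * (s ^ a / a) ≤ (gammaMeasure a r).real (Set.Iic s) := by
  have := isProbabilityMeasure_gammaMeasure ha hr
  refine (ENNReal.ofReal_le_iff_le_toReal (measure_ne_top _ _)).mp ?_
  rw [gammaMeasure_Iic_eq_lintegral hs, ← lintegral_Icc_rpow_sub_one ha hs (by positivity)]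
  refine setLIntegral_mono' measurableSet_Icc fun x hx => ENNReal.ofReal_le_ofReal ?_
  have h0 := hx.1
  have : exp (-(r * s)) ≤ exp (-(r * x)) := exp_le_exp.mpr (by nlinarith [hx.2])
  rw [mul_right_comm]
  gcongr

lemma tendsto_gammaMeasure_real_Iic_div_rpow {a r : ℝ} (ha : 0 < a) (hr : 0 < r) :
    Tendsto (fun s => (gammaMeasure a r).real (Set.Iic s) / s ^ a) (𝓝[>] 0)
      (𝓝 (r ^ a / Gamma a / a)) := by
  have hexp : Tendsto (fun s : ℝ => r ^ a / Gamma a / a * exp (-(r * s))) (𝓝[>] 0)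
      (𝓝 (r ^ a / Gamma a / a)) := by
    have : Continuous fun s : ℝ => r ^ a / Gamma a / a * exp (-(r * s)) := by fun_prop
    simpa using (this.tendsto 0).mono_left nhdsWithin_le_nhds
  refine tendsto_of_tendsto_of_tendsto_of_le_of_le' hexp tendsto_const_nhds ?_ ?_ <;>
    filter_upwards [self_mem_nhdsWithin] with s hs
  · rw [le_div_iff₀ (rpow_pos_of_pos hs a)]
    refine Eq.trans_le ?_ (le_gammaMeasure_real_Iic ha hr (le_of_lt hs))
    ring
  · rw [div_le_iff₀ (rpow_pos_of_pos hs a)]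
    refine (gammaMeasure_real_Iic_le ha hr (le_of_lt hs)).trans_eq ?_
    ring

lemma measureReal_mul_le_eq_integral {Ω : Type*} [MeasurableSpace Ω] {μ : Measure Ω}
    [IsProbabilityMeasure μ] {Y X : Ω → ℝ} (hY : Measurable Y) (hX : Measurable X)
    (hindep : IndepFun Y X μ) {g : ℝ → ℝ} (hg : Measurable g) (hg0 : ∀ x, 0 < g x) (t : ℝ) :
    μ.real {ω | Y ω * g (X ω) ≤ t} = ∫ x, (μ.map Y).real (Set.Iic (t / g x)) ∂(μ.map X) := by
  have := Measure.isProbabilityMeasure_map (μ := μ) hY.aemeasurable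
  have := Measure.isProbabilityMeasure_map (μ := μ) hX.aemeasurable
  have hS : MeasurableSet {p : ℝ × ℝ | p.1 * g p.2 ≤ t} :=
    measurableSet_le (by fun_prop) measurable_const
  have hpre (x : ℝ) :
      (fun y => (y, x)) ⁻¹' {p : ℝ × ℝ | p.1 * g p.2 ≤ t} = Set.Iic (t / g x) := by
    ext y
    simp [le_div_iff₀ (hg0 x)]
  have hmeas : Measurable fun x => μ.map Y (Set.Iic (t / g x)) := by
    simpa only [hpre] using measurable_measure_prodMk_right (μ := μ.map Y) hS
  have h1 : μ {ω | Y ω * g (X ω) ≤ t} = ∫⁻ x, μ.map Y (Set.Iic (t / g x)) ∂(μ.map X) := by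
    simp_rw [← hpre]
    rw [← Measure.prod_apply_symm hS,
      ← (indepFun_iff_map_prod_eq_prod_map_map hY.aemeasurable hX.aemeasurable).mp hindep,
      Measure.map_apply (hY.prodMk hX) hS]
    rfl
  rw [measureReal_def, h1,
    ← integral_toReal hmeas.aemeasurable (ae_of_all _ fun _ => measure_lt_top _ _)]
  rfl

/-- The CDF of a Gamma variable scaled by an independent positive factor `g` decays like `t ^ a`
at `0`, with the constant governed by the moment of order `-a` of that factor. -/
lemma tendsto_integral_gammaMeasure_real_Iic_div {a r : ℝ} (ha : 0 < a) (hr : 0 < r)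
    {ν : Measure ℝ} {g : ℝ → ℝ} (hg : Measurable g) (hg0 : ∀ x, 0 < g x)
    (hint : Integrable (fun x => g x ^ (-a)) ν) :
    Tendsto (fun t => (∫ x, (gammaMeasure a r).real (Set.Iic (t / g x)) ∂ν) / t ^ a) (𝓝[>] 0)
      (𝓝 (∫ x, r ^ a / Gamma a / a * g x ^ (-a) ∂ν)) := by
  have := isProbabilityMeasure_gammaMeasure ha hr
  have hmono : Monotone fun s => (gammaMeasure a r).real (Set.Iic s) := fun s t hst =>
    measureReal_mono (Set.Iic_subset_Iic.mpr hst)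
  simp_rw [← integral_div]
  refine tendsto_integral_filter_of_dominated_convergence
    (fun x => r ^ a / Gamma a / a * g x ^ (-a)) ?_ ?_ (hint.const_mul _) ?_
  · refine Eventually.of_forall fun t => Measurable.aestronglyMeasurable ?_
    exact (hmono.measurable.comp (hg.const_div t)).div_const _
  · filter_upwards [self_mem_nhdsWithin] with t ht
    refine ae_of_all _ fun x => ?_
    have ht0 : 0 < t := ht
    have hx := hg0 x
    rw [norm_of_nonneg (by positivity), div_le_iff₀ (by positivity)]
    refine (gammaMeasure_real_Iic_le ha hr (by positivity)).trans_eq ?_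
    rw [div_rpow ht0.le hx.le, rpow_neg hx.le]
    field_simp
  · refine ae_of_all _ fun x => ?_
    have hx := hg0 x
    have hlim : Tendsto (fun t => t / g x) (𝓝[>] 0) (𝓝[>] 0) := by
      refine tendsto_nhdsWithin_iff.mpr ⟨?_, ?_⟩
      · simpa using ((continuous_id.div_const (g x)).tendsto 0).mono_left nhdsWithin_le_nhds
      · filter_upwards [self_mem_nhdsWithin] with t ht using div_pos ht hx
    refine (((tendsto_gammaMeasure_real_Iic_div_rpow ha hr).comp hlim).mul_const
      (g x ^ (-a))).congr' ?_
    filter_upwards [self_mem_nhdsWithin] with t ht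
    have ht0 : 0 < t := ht
    simp only [Function.comp]
    rw [div_rpow ht0.le hx.le, rpow_neg hx.le]
    field_simp

lemma integrable_gaussianPDFReal_smul {c : ℝ} {v : NNReal} (hv : v ≠ 0) {f : ℝ → ℝ}
    (hf : Integrable f (gaussianReal c v)) : Integrable fun x => gaussianPDFReal c v x • f x := by
  rw [gaussianReal_of_var_ne_zero _ hv, integrable_withDensity_iff_integrable_smul'
    (measurable_gaussianPDF _ _) (ae_of_all _ fun _ => gaussianPDF_lt_top)] at hf
  simpa only [toReal_gaussianPDF] using hf

lemma ten_rpow_div_ten (x : ℝ) : (10 : ℝ) ^ (x / 10) = exp (Real.log 10 / 10 * x) := by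
  rw [rpow_def_of_pos (by norm_num)]
  ring_nf

lemma image_exp_const_mul {k : ℝ} (hk : 0 < k) :
    (fun x => exp (k * x)) '' Set.univ = Set.Ioi 0 := by
  rw [Set.image_univ, ← range_exp]
  exact (mul_left_surjective₀ hk.ne').range_comp exp

/-- Pulling the log-normal integrand back along `x ↦ 10 ^ (x / 10)` gives a Gaussian density. -/
lemma abs_deriv_smul_eq_gaussianPDFReal_smul {m σ : ℝ} (hm : 0 < m) (hσ : 0 < σ) (x : ℝ) :
    |exp (Real.log 10 / 10 * x) * (Real.log 10 / 10)| •
      (10 * m ^ (m - 1) / (σ * Real.log 10 * Real.sqrt (2 * π) * Real.Gamma m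
          * exp (Real.log 10 / 10 * x) ^ (m + 1))
        * Real.exp (-(10 * Real.log (exp (Real.log 10 / 10 * x))
          / (σ * Real.sqrt 2 * Real.log 10)) ^ 2)) =
    gaussianPDFReal 0 ⟨σ ^ 2, sq_nonneg σ⟩ x •
      (m ^ m / Real.Gamma m / m * ((10 : ℝ) ^ (x / 10)) ^ (-m)) := by
  have hlog : 0 < Real.log 10 := Real.log_pos (by norm_num)
  have hG := Gamma_pos_of_pos hm
  have hexp : -(10 * (Real.log 10 / 10 * x) / (σ * √2 * Real.log 10)) ^ 2 =
      -(x - 0) ^ 2 / (2 * σ ^ 2) := by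
    field_simp
    rw [sq_sqrt zero_le_two]
    ring
  have hsqrt : √(2 * π * σ ^ 2) = √(2 * π) * σ := by
    rw [sqrt_mul (by positivity), sqrt_sq hσ.le]
  have hpdf : gaussianPDFReal 0 ⟨σ ^ 2, sq_nonneg σ⟩ x =
      (√(2 * π * σ ^ 2))⁻¹ * exp (-(x - 0) ^ 2 / (2 * σ ^ 2)) := rfl
  rw [ten_rpow_div_ten, log_exp, hexp, hpdf, hsqrt,
    abs_of_pos (by positivity), rpow_add_one (exp_pos _).ne', rpow_neg (exp_pos _).le,
    rpow_sub_one hm.ne', smul_eq_mul, smul_eq_mul]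
  field_simp

/-- Lemma 2, property 1: for composite fading `h = h̃·ĥ` with `h̃ ~ Gamma(m, m)`
(Nakagami-`m` power) independent of `X ~ N(0, σ²)` and `ĥ = 10^(X/10)` (log-normal
shadowing), the CDF of `h` satisfies `F_h(t)/t^m → ∫_0^∞ (10 m^(m-1))/(σ ln10 √(2π) Γ(m)
u^(m+1)) exp(−(10 ln u/(σ√2 ln10))²) du` as `t → 0⁺`, and this integral is finite. -/
theorem composite_fading_cdf_at_zero {Ω : Type*} [MeasurableSpace Ω] (μ : Measure Ω)
    [IsProbabilityMeasure μ] (m σ : ℝ) (hm : 0 < m) (hσ : 0 < σ)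
    (X htilde : Ω → ℝ) (hX : Measurable X) (hht : Measurable htilde)
    (hXlaw : μ.map X = ProbabilityTheory.gaussianReal 0 ⟨σ ^ 2, sq_nonneg σ⟩)
    (hhtlaw : μ.map htilde = ProbabilityTheory.gammaMeasure m m)
    (hindep : ProbabilityTheory.IndepFun htilde X μ) :
    IntegrableOn (fun u : ℝ =>
        10 * m ^ (m - 1) / (σ * Real.log 10 * Real.sqrt (2 * π) * Real.Gamma m * u ^ (m + 1))
          * Real.exp (-(10 * Real.log u / (σ * Real.sqrt 2 * Real.log 10)) ^ 2))
      (Set.Ioi 0) ∧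
    Tendsto (fun t => (μ {ω | htilde ω * (10 : ℝ) ^ (X ω / 10) ≤ t}).toReal / t ^ m)
      (𝓝[>] 0)
      (𝓝 (∫ u in Set.Ioi (0 : ℝ),
        10 * m ^ (m - 1) / (σ * Real.log 10 * Real.sqrt (2 * π) * Real.Gamma m * u ^ (m + 1))
          * Real.exp (-(10 * Real.log u / (σ * Real.sqrt 2 * Real.log 10)) ^ 2))) := by
  have hk : 0 < Real.log 10 / 10 := by have := Real.log_pos (x := 10) (by norm_num); positivity
  have hv : (⟨σ ^ 2, sq_nonneg σ⟩ : NNReal) ≠ 0 :=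
    fun h => (pow_pos hσ 2).ne' (congrArg NNReal.toReal h)
  have hint : Integrable (fun x : ℝ => ((10 : ℝ) ^ (x / 10)) ^ (-m))
      (gaussianReal 0 ⟨σ ^ 2, sq_nonneg σ⟩) := by
    have h (x : ℝ) : ((10 : ℝ) ^ (x / 10)) ^ (-m) = exp (-m * (Real.log 10 / 10) * x) := by
      rw [ten_rpow_div_ten, ← exp_mul]
      ring_nf
    simpa only [h] using integrable_exp_mul_gaussianReal (-m * (Real.log 10 / 10))
  have hderiv (x : ℝ) (_ : x ∈ Set.univ) : HasDerivWithinAt (fun x => exp (Real.log 10 / 10 * x))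
      (exp (Real.log 10 / 10 * x) * (Real.log 10 / 10)) Set.univ x := by
    simpa using ((hasDerivAt_id x).const_mul (Real.log 10 / 10)).exp
  have hinj : Set.InjOn (fun x => exp (Real.log 10 / 10 * x)) Set.univ := fun x _ y _ h =>
    mul_left_cancel₀ hk.ne' (exp_injective h)
  have hon := integrableOn_image_iff_integrableOn_abs_deriv_smul (F := ℝ) .univ hderiv hinj
  have heq := integral_image_eq_integral_abs_deriv_smul (F := ℝ) .univ hderiv hinj
  rw [image_exp_const_mul hk] at hon heq
  rw [hon, heq]
  simp only [abs_deriv_smul_eq_gaussianPDFReal_smul hm hσ, integrableOn_univ, Measure.restrict_univ]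
  constructor
  · exact integrable_gaussianPDFReal_smul hv (hint.const_mul _)
  · rw [← integral_gaussianReal_eq_integral_smul hv]
    have hg : Measurable fun x : ℝ => (10 : ℝ) ^ (x / 10) := by fun_prop
    have hg0 (x : ℝ) : 0 < (10 : ℝ) ^ (x / 10) := by positivity
    refine (tendsto_integral_gammaMeasure_real_Iic_div hm hm hg hg0 hint).congr fun t => ?_
    rw [← hhtlaw, ← hXlaw, ← measureReal_mul_le_eq_integral hht hX hindep hg hg0, measureReal_def]
end

section
/- Let m > 0, σ > 0. Let X be a real Gaussian random variable with mean 0 and variance σ², set ĥ = 10^{X/10}, and let h̃ be a random variable with the Gamma distribution of shape m and rate m, independent of X. Let h = h̃·ĥ. Then for every n ∈ ℕ, t^n · P(h > t) → 0 as t → ∞, i.e., the complementary CDF of h satisfies F_h^c(t) = o(t^{-n}) for every n. -/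
open MeasureTheory Filter Topology

/-- All moments of the gamma distribution are finite. -/
lemma ProbabilityTheory.integrable_abs_pow_gammaMeasure {a r : ℝ} (ha : 0 < a) (hr : 0 < r)
    (k : ℕ) : Integrable (fun x : ℝ => |x| ^ k) (gammaMeasure a r) := by
  have hmeas : Measurable (gammaPDF a r) := (measurable_gammaPDFReal a r).ennreal_ofReal
  rw [gammaMeasure, integrable_withDensity_iff_integrable_smul' hmeas
    (ae_of_all _ fun _ => ENNReal.ofReal_lt_top)]
  simp only [gammaPDF, ENNReal.toReal_ofReal (gammaPDFReal_nonneg ha hr _), smul_eq_mul]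
  have hk : (-1 : ℝ) < a - 1 + k := by
    have := k.cast_nonneg (α := ℝ)
    linarith
  have hint : Integrable ((Set.Ioi (0 : ℝ)).indicator fun x =>
      r ^ a / Real.Gamma a * (x ^ (a - 1 + k) * Real.exp (-r * x ^ (1 : ℝ)))) :=
    (integrable_indicator_iff measurableSet_Ioi).2
      ((integrableOn_rpow_mul_exp_neg_mul_rpow hk one_pos hr).const_mul _)
  refine hint.congr ?_
  filter_upwards [Measure.ae_ne volume (0 : ℝ)] with x hx
  rcases lt_or_gt_of_ne hx with h | h
  · simp [gammaPDFReal, h.not_ge, h.le]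
  · rw [Set.indicator_of_mem (Set.mem_Ioi.2 h), gammaPDFReal, if_pos h.le, abs_of_pos h,
      Real.rpow_add h, Real.rpow_natCast, Real.rpow_one, neg_mul]
    ring

/-- A finite absolute moment of order `n + 1` forces the upper tail to be `o(t⁻ⁿ)`. -/
lemma tendsto_pow_mul_measure_gt_of_integrable {Ω : Type*} [MeasurableSpace Ω] {μ : Measure Ω}
    [IsFiniteMeasure μ] {Y : Ω → ℝ} {n : ℕ} (hY : Integrable (fun ω => |Y ω| ^ (n + 1)) μ) :
    Tendsto (fun t : ℝ => t ^ n * (μ {ω | t < Y ω}).toReal) atTop (𝓝 0) := by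
  refine squeeze_zero' ?_ ?_
    (tendsto_const_nhds.div_atTop tendsto_id : Tendsto
      (fun t : ℝ => (∫ ω, |Y ω| ^ (n + 1) ∂μ) / t) atTop (𝓝 0))
  · filter_upwards [eventually_ge_atTop 0] with t ht
    positivity
  · filter_upwards [eventually_gt_atTop 0] with t ht
    have hsub : {ω | t < Y ω} ⊆ {ω | t ^ (n + 1) ≤ |Y ω| ^ (n + 1)} := by
      intro ω (hω : t < Y ω)
      exact pow_le_pow_left₀ ht.le (hω.le.trans (le_abs_self _)) _
    rw [le_div_iff₀ ht]
    calc t ^ n * (μ {ω | t < Y ω}).toReal * t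
        = t ^ (n + 1) * μ.real {ω | t < Y ω} := by rw [measureReal_def]; ring
      _ ≤ t ^ (n + 1) * μ.real {ω | t ^ (n + 1) ≤ |Y ω| ^ (n + 1)} := by
          exact mul_le_mul_of_nonneg_left (measureReal_mono hsub) (by positivity)
      _ ≤ ∫ ω, |Y ω| ^ (n + 1) ∂μ :=
          mul_meas_ge_le_integral_of_nonneg (ae_of_all _ fun ω => by positivity) hY _

/-- Lemma 2, property 2 (first half): the tail of composite fading `h = h̃·ĥ`
(Nakagami-`m` times log-normal) decays faster than any power: for every `n`,
`t^n · P(h > t) → 0` as `t → ∞`. -/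
theorem composite_fading_tail_power {Ω : Type*} [MeasurableSpace Ω] (μ : Measure Ω)
    [IsProbabilityMeasure μ] (m σ : ℝ) (hm : 0 < m) (hσ : 0 < σ)
    (X htilde : Ω → ℝ) (hX : Measurable X) (hht : Measurable htilde)
    (hXlaw : μ.map X = ProbabilityTheory.gaussianReal 0 ⟨σ ^ 2, sq_nonneg σ⟩)
    (hhtlaw : μ.map htilde = ProbabilityTheory.gammaMeasure m m)
    (hindep : ProbabilityTheory.IndepFun htilde X μ) :
    ∀ n : ℕ, Tendsto
      (fun t : ℝ => t ^ n * (μ {ω | t < htilde ω * (10 : ℝ) ^ (X ω / 10)}).toReal)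
      atTop (𝓝 0) := by
  intro n
  apply tendsto_pow_mul_measure_gt_of_integrable
  have hgamma : Integrable (fun ω => |htilde ω| ^ (n + 1)) μ := by
    have h := ProbabilityTheory.integrable_abs_pow_gammaMeasure hm hm (n + 1)
    rw [← hhtlaw] at h
    exact h.comp_measurable hht
  have hlognormal : Integrable (fun ω => ((10 : ℝ) ^ (X ω / 10)) ^ (n + 1)) μ := by
    have h := ProbabilityTheory.integrable_exp_mul_gaussianReal (μ := 0)
      (v := ⟨σ ^ 2, sq_nonneg σ⟩) (Real.log 10 / 10 * (n + 1))
    rw [← hXlaw] at h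
    refine (h.comp_measurable hX).congr (ae_of_all _ fun ω => ?_)
    simp only [Function.comp_apply]
    rw [Real.rpow_def_of_pos (by norm_num), ← Real.exp_nat_mul]
    congr 1
    push_cast
    ring
  have hind : ProbabilityTheory.IndepFun (fun ω => |htilde ω| ^ (n + 1))
      (fun ω => ((10 : ℝ) ^ (X ω / 10)) ^ (n + 1)) μ :=
    hindep.comp (φ := fun x : ℝ => |x| ^ (n + 1))
      (ψ := fun x : ℝ => ((10 : ℝ) ^ (x / 10)) ^ (n + 1)) (by fun_prop) (by fun_prop)
  refine (hind.integrable_mul hgamma hlognormal).congr (ae_of_all _ fun ω => ?_)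
  simp only [Pi.mul_apply]
  rw [abs_mul, mul_pow, abs_of_pos (Real.rpow_pos_of_pos (by norm_num) (X ω / 10))]
end

section
/- Let m > 0, σ > 0. Let X be a real Gaussian random variable with mean 0 and variance σ², set ĥ = 10^{X/10}, and let h̃ be a random variable with the Gamma distribution of shape m and rate m, independent of X. Let h = h̃·ĥ. Then for every a > 0, P(h > t)/exp(−a t) → ∞ as t → ∞; equivalently, −log P(h > t) = o(t) as t → ∞. -/
open MeasureTheory Filter Topology

/-- A Gamma law charges every right tail. -/
lemma gammaMeasure_Ioi_pos {r s x : ℝ} (hr : 0 < r) (hs : 0 < s) (hx : 0 ≤ x) :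
    0 < ProbabilityTheory.gammaMeasure r s (Set.Ioi x) := by
  rw [ProbabilityTheory.gammaMeasure, withDensity_apply _ measurableSet_Ioi,
    setLIntegral_pos_iff (f := ProbabilityTheory.gammaPDF r s)
      (ProbabilityTheory.measurable_gammaPDFReal r s).ennreal_ofReal]
  have hsub : Set.Ioi x ⊆ Function.support (ProbabilityTheory.gammaPDF r s) ∩ Set.Ioi x := by
    intro y hy
    refine ⟨?_, hy⟩
    simpa [ProbabilityTheory.gammaPDF] using
      ProbabilityTheory.gammaPDFReal_pos hr hs (hx.trans_lt hy)
  exact lt_of_lt_of_le (by simp) (measure_mono hsub)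

/-- A lower bound for the right tail of a centered Gaussian law: the density at `x + 1`. -/
lemma gaussianPDFReal_add_one_le_gaussianReal_Ici {v : NNReal} (hv : v ≠ 0) {x : ℝ} (hx : 0 ≤ x) :
    ProbabilityTheory.gaussianPDFReal 0 v (x + 1) ≤
      (ProbabilityTheory.gaussianReal 0 v (Set.Ici x)).toReal := by
  rw [← ENNReal.ofReal_le_iff_le_toReal (measure_ne_top _ _)]
  calc ENNReal.ofReal (ProbabilityTheory.gaussianPDFReal 0 v (x + 1))
      = ∫⁻ _ in Set.Icc x (x + 1),
          ENNReal.ofReal (ProbabilityTheory.gaussianPDFReal 0 v (x + 1)) := by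
        simp
    _ ≤ ∫⁻ y in Set.Icc x (x + 1), ProbabilityTheory.gaussianPDF 0 v y := by
        refine setLIntegral_mono (ProbabilityTheory.measurable_gaussianPDF 0 v) fun y hy => ?_
        refine ENNReal.ofReal_le_ofReal ?_
        have h0 : 0 ≤ y := hx.trans hy.1
        have h1 : y ≤ x + 1 := hy.2
        simp only [ProbabilityTheory.gaussianPDFReal, sub_zero]
        gcongr
    _ ≤ ProbabilityTheory.gaussianReal 0 v (Set.Ici x) := by
        rw [← ProbabilityTheory.gaussianReal_apply 0 hv]
        exact measure_mono Set.Icc_subset_Ici_self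

/-- A linear function dominates any quadratic polynomial in the logarithm. -/
lemma tendsto_mul_sub_sq_log_atTop {a : ℝ} (ha : 0 < a) (k w : ℝ) :
    Tendsto (fun t : ℝ => a * t - (k * Real.log t + 1) ^ 2 / w) atTop atTop := by
  have h2 : (fun t : ℝ => Real.log t ^ 2) =o[atTop] fun t : ℝ => t :=
    Real.isLittleO_pow_log_id_atTop
  have h1 : (fun t : ℝ => Real.log t) =o[atTop] fun t : ℝ => t := Real.isLittleO_log_id_atTop
  have h0 : (fun _ : ℝ => (1 : ℝ)) =o[atTop] fun t : ℝ => t :=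
     Asymptotics.isLittleO_const_id_atTop 1
  have h : (fun t : ℝ => (k * Real.log t + 1) ^ 2 / w) =o[atTop] fun t : ℝ => t := by
    refine (((h2.const_mul_left (k ^ 2 / w)).add (h1.const_mul_left (2 * k / w))).add
      (h0.const_mul_left (1 / w))).congr_left fun t => ?_
    ring
  refine tendsto_atTop_mono' atTop ?_ (tendsto_id.const_mul_atTop (half_pos ha))
  filter_upwards [h.bound (half_pos ha), eventually_ge_atTop 0] with t ht ht0
  have hle := (le_abs_self _).trans ht
  rw [Real.norm_of_nonneg ht0] at hle
  simp only [id]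
  linarith

/-- Lemma 2, property 2 (second half): the tail of composite fading `h = h̃·ĥ`
(Nakagami-`m` times log-normal) decays slower than any exponential: for every `a > 0`,
`P(h > t)/exp(−a t) → ∞` as `t → ∞`. -/
theorem composite_fading_tail_subexponential {Ω : Type*} [MeasurableSpace Ω] (μ : Measure Ω)
    [IsProbabilityMeasure μ] (m σ : ℝ) (hm : 0 < m) (hσ : 0 < σ)
    (X htilde : Ω → ℝ) (hX : Measurable X) (hht : Measurable htilde)
    (hXlaw : μ.map X = ProbabilityTheory.gaussianReal 0 ⟨σ ^ 2, sq_nonneg σ⟩)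
    (hhtlaw : μ.map htilde = ProbabilityTheory.gammaMeasure m m)
    (hindep : ProbabilityTheory.IndepFun htilde X μ) :
    ∀ a : ℝ, 0 < a → Tendsto
      (fun t : ℝ => (μ {ω | t < htilde ω * (10 : ℝ) ^ (X ω / 10)}).toReal / Real.exp (-a * t))
      atTop atTop := by
  intro a ha
  set v : NNReal := ⟨σ ^ 2, sq_nonneg σ⟩
  have hv : v ≠ 0 := by
    intro h
    have h' : σ ^ 2 = 0 := congrArg NNReal.toReal h
    exact (pow_pos hσ 2).ne' h'
  set p : ℝ := (μ (htilde ⁻¹' Set.Ioi 1)).toReal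
  have hp : 0 < p := by
    refine ENNReal.toReal_pos ?_ (measure_ne_top _ _)
    rw [← Measure.map_apply hht measurableSet_Ioi, hhtlaw]
    exact (gammaMeasure_Ioi_pos hm hm zero_le_one).ne'
  have hlog : 0 < Real.log 10 := Real.log_pos (by norm_num)
  set k : ℝ := 10 / Real.log 10 with hk_def
  have hk : 0 < k := by positivity
  set c : ℝ := (√(2 * Real.pi * v))⁻¹
  have hc : 0 < c := by positivity
  have hlower : ∀ t : ℝ, 1 ≤ t →
      p * c * Real.exp (-(k * Real.log t + 1) ^ 2 / (2 * v)) ≤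
        (μ {ω | t < htilde ω * (10 : ℝ) ^ (X ω / 10)}).toReal := by
    intro t ht
    have ht0 : 0 < t := by linarith
    have hx : 0 ≤ k * Real.log t := mul_nonneg hk.le (Real.log_nonneg ht)
    have hg := gaussianPDFReal_add_one_le_gaussianReal_Ici hv hx
    rw [← hXlaw, Measure.map_apply hX measurableSet_Ici] at hg
    simp only [ProbabilityTheory.gaussianPDFReal, sub_zero] at hg
    have hsub : htilde ⁻¹' Set.Ioi 1 ∩ X ⁻¹' Set.Ici (k * Real.log t) ⊆
        {ω | t < htilde ω * (10 : ℝ) ^ (X ω / 10)} := by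
      rintro ω ⟨h1, h2⟩
      simp only [Set.mem_preimage, Set.mem_Ioi, Set.mem_Ici] at h1 h2
      have hpow : t ≤ (10 : ℝ) ^ (X ω / 10) := by
        rw [Real.le_rpow_iff_log_le ht0 (by norm_num)]
        rw [hk_def, div_mul_eq_mul_div, div_le_iff₀ hlog] at h2
        linarith
      exact hpow.trans_lt (lt_mul_of_one_lt_left (ht0.trans_le hpow) h1)
    calc p * c * Real.exp (-(k * Real.log t + 1) ^ 2 / (2 * v))
        ≤ p * (μ (X ⁻¹' Set.Ici (k * Real.log t))).toReal := by
          rw [mul_assoc]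
          exact mul_le_mul_of_nonneg_left hg hp.le
      _ = (μ (htilde ⁻¹' Set.Ioi 1 ∩ X ⁻¹' Set.Ici (k * Real.log t))).toReal := by
          rw [hindep.measure_inter_preimage_eq_mul _ _ measurableSet_Ioi measurableSet_Ici,
            ENNReal.toReal_mul]
      _ ≤ _ := ENNReal.toReal_mono (measure_ne_top _ _) (measure_mono hsub)
  refine tendsto_atTop_mono' atTop ?_
    ((Real.tendsto_exp_atTop.comp (tendsto_mul_sub_sq_log_atTop ha k (2 * v))).const_mul_atTop
      (mul_pos hp hc))
  filter_upwards [eventually_ge_atTop 1] with t ht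
  rw [le_div_iff₀ (Real.exp_pos _), Function.comp_apply, mul_assoc, ← Real.exp_add]
  refine le_trans (le_of_eq ?_) (hlower t ht)
  congr 2
  ring
end
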